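/- Let Σ be a set of autoepistemic formulas and φ an autoepistemic formula, all built using only the connectives ⊕ (exclusive or) and the constant ⊤, and let p be a propositional variable occurring neither in Σ nor in φ. Then φ is contained in some stable expansion of Σ if and only if Σ' := Σ ∪ {Lφ ⊕ p ⊕ ⊤, Lp} has a stable expansion. -/

import Mathlib

/-- Autoepistemic formulas: propositional variables, Boolean connectives
`⊤, ⊥, ¬, ∧, ∨, ⊕`, and the modal operator `L` (`box`). -/
inductive AE : Type
  | var : ℕ → AE
  | top : AE
  | bot : AE
  | neg : AE → AE
  | conj : AE → AE → AE
  | disj : AE → AE → AE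
  | xor : AE → AE → AE
  | box : AE → AE
  deriving DecidableEq

namespace AE

/-- Propositional evaluation of an autoepistemic formula, where `v` assigns
truth values to propositional variables and `w` assigns truth values to
`L`-prefixed formulas (which are treated as atoms). -/
def eval (v : ℕ → Bool) (w : AE → Bool) : AE → Bool
  | var n => v n
  | top => true
  | bot => false
  | neg φ => !(eval v w φ)
  | conj φ ψ => eval v w φ && eval v w ψ
  | disj φ ψ => eval v w φ || eval v w ψ
  | xor φ ψ => (eval v w φ) != (eval v w ψ)
  | box φ => w φ

/-- Propositional consequence, treating `L`-prefixed formulas as atoms. -/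
def entails (S : Set AE) (φ : AE) : Prop :=
  ∀ v w, (∀ ψ ∈ S, eval v w ψ = true) → eval v w φ = true

/-- Deductive closure. -/
def Th (S : Set AE) : Set AE := {φ | entails S φ}

/-- `Δ` is a stable expansion of `S` if `Δ = Th (S ∪ L(Δ) ∪ ¬L(Δᶜ))`. -/
def IsStableExpansion (S Δ : Set AE) : Prop :=
  Δ = Th (S ∪ (box '' Δ) ∪ ((fun φ => neg (box φ)) '' Δᶜ))

/-- The set of subformulas of a formula (including the formula itself). -/
def subf : AE → Set AE
  | var n => {var n}
  | top => {top}
  | bot => {bot}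
  | neg φ => insert (neg φ) (subf φ)
  | conj φ ψ => insert (conj φ ψ) (subf φ ∪ subf ψ)
  | disj φ ψ => insert (disj φ ψ) (subf φ ∪ subf ψ)
  | xor φ ψ => insert (xor φ ψ) (subf φ ∪ subf ψ)
  | box φ => insert (box φ) (subf φ)

/-- `SF^L(S)`: the `L`-prefixed subformulas of formulas in `S`. -/
def SFL (S : Set AE) : Set AE := {χ | (∃ φ ∈ S, χ ∈ subf φ) ∧ ∃ ψ, χ = box ψ}

/-- `¬SF^L(S)`. -/
def negSFL (S : Set AE) : Set AE := neg '' SFL S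

/-- `Λ` is an `S`-full set. -/
def IsFull (S Λ : Set AE) : Prop :=
  Λ ⊆ SFL S ∪ negSFL S ∧
  ∀ φ, box φ ∈ SFL S →
    (entails (S ∪ Λ) φ ↔ box φ ∈ Λ) ∧ (¬ entails (S ∪ Λ) φ ↔ neg (box φ) ∈ Λ)


/-- Formulas built using only the connectives `⊕` and the constant `⊤`
(besides variables and the modal operator `L`). -/
def IsXorTop : AE → Prop
  | var _ => True
  | top => True
  | xor φ ψ => IsXorTop φ ∧ IsXorTop ψ
  | box φ => IsXorTop φ
  | _ => False

/-- The valuation of `L`-atoms induced by a set of formulas. -/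
noncomputable def atomVal (Δ : Set AE) : AE → Bool :=
  open Classical in fun ψ => decide (ψ ∈ Δ)

theorem atomVal_eq_true {Δ : Set AE} {ψ : AE} : atomVal Δ ψ = true ↔ ψ ∈ Δ := by
  simp [atomVal]

/-- The propositional valuations satisfying `S` when `L`-atoms are read off from `Δ`. -/
def models (S Δ : Set AE) : Set (ℕ → Bool) :=
  {v | ∀ ρ ∈ S, eval v (atomVal Δ) ρ = true}

theorem isStableExpansion_iff {S Δ : Set AE} :
    IsStableExpansion S Δ ↔
      ∀ ψ, ψ ∈ Δ ↔ ∀ v ∈ models S Δ, eval v (atomVal Δ) ψ = true := by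
  have key : ∀ v w, (∀ ψ ∈ S ∪ (box '' Δ) ∪ ((fun φ => neg (box φ)) '' Δᶜ),
      eval v w ψ = true) ↔ w = atomVal Δ ∧ v ∈ models S Δ := by
    intro v w
    constructor
    · intro h
      have hw : w = atomVal Δ := by
        funext ψ
        by_cases hψ : ψ ∈ Δ
        · have := h (box ψ) (Or.inl (Or.inr ⟨ψ, hψ, rfl⟩))
          simpa [eval, atomVal, hψ] using this
        · have := h (neg (box ψ)) (Or.inr ⟨ψ, hψ, rfl⟩)
          simpa [eval, atomVal, hψ] using this
      subst hw
      exact ⟨rfl, fun ρ hρ => h ρ (Or.inl (Or.inl hρ))⟩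
    · rintro ⟨rfl, hv⟩ ψ ((hψ | ⟨χ, hχ, rfl⟩) | ⟨χ, hχ, rfl⟩)
      · exact hv ψ hψ
      · simpa [eval, atomVal] using hχ
      · simpa [eval, atomVal] using hχ
  unfold IsStableExpansion
  rw [Set.ext_iff]
  refine forall_congr' fun ψ => iff_congr Iff.rfl ?_
  simp only [Th, entails, Set.mem_ofPred_eq, key]
  exact ⟨fun h v hv => h v _ ⟨rfl, hv⟩, fun h v w ⟨hw, hv⟩ => hw ▸ h v hv⟩

theorem eval_update_of_notMem {p : ℕ} {ψ : AE} (h : var p ∉ subf ψ)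
    (v : ℕ → Bool) (w : AE → Bool) (b : Bool) :
    eval (Function.update v p b) w ψ = eval v w ψ := by
  induction ψ with
  | var n =>
    have hn : n ≠ p := by rintro rfl; simp [subf] at h
    simp [eval, hn]
  | _ => simp_all [subf, eval]

/-- Replace the variable `p` by `⊤`, also inside the scope of `L`. -/
def substTop (p : ℕ) : AE → AE
  | var n => if n = p then top else var n
  | top => top
  | bot => bot
  | neg φ => neg (substTop p φ)
  | conj φ ψ => conj (substTop p φ) (substTop p ψ)
  | disj φ ψ => disj (substTop p φ) (substTop p ψ)
  | xor φ ψ => xor (substTop p φ) (substTop p ψ)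
  | box φ => box (substTop p φ)

theorem substTop_of_notMem {p : ℕ} {ψ : AE} (h : var p ∉ subf ψ) : substTop p ψ = ψ := by
  induction ψ with
  | var n =>
    have hn : n ≠ p := by rintro rfl; simp [subf] at h
    simp [substTop, hn]
  | _ => simp_all [subf, substTop]

theorem eval_substTop (p : ℕ) (v : ℕ → Bool) (Δ : Set AE) (ψ : AE) :
    eval v (atomVal Δ) (substTop p ψ) =
      eval (Function.update v p true) (atomVal (substTop p ⁻¹' Δ)) ψ := by
  induction ψ with
  | var n => by_cases hn : n = p <;> simp [substTop, eval, hn]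
  | box ψ _ => simp [substTop, eval, atomVal]
  | _ => simp_all [substTop, eval]

/-- Evaluation over a set `M` of valuations, with `L` read as truth in all members of `M`. -/
noncomputable def kripkeEval (M : Set (ℕ → Bool)) : AE → (ℕ → Bool) → Bool
  | var n, v => v n
  | top, _ => true
  | bot, _ => false
  | neg φ, v => !(kripkeEval M φ v)
  | conj φ ψ, v => kripkeEval M φ v && kripkeEval M ψ v
  | disj φ ψ, v => kripkeEval M φ v || kripkeEval M ψ v
  | xor φ ψ, v => (kripkeEval M φ v) != (kripkeEval M ψ v)
  | box φ, _ => open Classical in decide (∀ u ∈ M, kripkeEval M φ u = true)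

/-- The formulas true in all members of `M`. -/
def kripkeTheory (M : Set (ℕ → Bool)) : Set AE :=
  {ψ | ∀ v ∈ M, kripkeEval M ψ v = true}

theorem eval_kripkeTheory (M : Set (ℕ → Bool)) (v : ℕ → Bool) (ψ : AE) :
    eval v (atomVal (kripkeTheory M)) ψ = kripkeEval M ψ v := by
  induction ψ with
  | box ψ _ =>
    rw [Bool.eq_iff_iff]
    simp [eval, kripkeEval, atomVal_eq_true, kripkeTheory]
  | _ => simp_all [eval, kripkeEval]

theorem isStableExpansion_kripkeTheory {S : Set AE} {M : Set (ℕ → Bool)}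
    (h : models S (kripkeTheory M) = M) : IsStableExpansion S (kripkeTheory M) := by
  rw [isStableExpansion_iff, h]
  simp only [eval_kripkeTheory]
  exact fun _ => Iff.rfl

/-- The extension `Σ ∪ {Lφ ⊕ p ⊕ ⊤, Lp}` of `Σ`. -/
abbrev braveExt (S : Set AE) (φ : AE) (p : ℕ) : Set AE :=
  S ∪ {xor (box φ) (xor (var p) top), box (var p)}

theorem mem_models_braveExt {S Δ : Set AE} {φ : AE} {p : ℕ} {v : ℕ → Bool} :
    v ∈ models (braveExt S φ p) Δ ↔
      v ∈ models S Δ ∧ (φ ∈ Δ ↔ v p = true) ∧ var p ∈ Δ := by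
  have hx : eval v (atomVal Δ) (xor (box φ) (xor (var p) top)) = true ↔
      (φ ∈ Δ ↔ v p = true) := by
    rw [← atomVal_eq_true (Δ := Δ)]
    simp only [eval]
    cases atomVal Δ φ <;> cases v p <;> simp
  have hb : eval v (atomVal Δ) (box (var p)) = true ↔ var p ∈ Δ := atomVal_eq_true
  constructor
  · intro h
    exact ⟨fun ρ hρ => h ρ (Or.inl hρ), hx.1 (h _ (by simp)), hb.1 (h _ (by simp))⟩
  · rintro ⟨h, h1, h2⟩ ρ (hρ | rfl | rfl)
    exacts [h ρ hρ, hx.2 h1, hb.2 h2]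

theorem update_mem_models {S Δ : Set AE} {p : ℕ} (hpS : ∀ ρ ∈ S, var p ∉ subf ρ)
    {v : ℕ → Bool} (hv : v ∈ models S Δ) (b : Bool) :
    Function.update v p b ∈ models S Δ := fun ρ hρ => by
  rw [eval_update_of_notMem (hpS ρ hρ)]; exact hv ρ hρ

theorem IsStableExpansion.braveExt {S Δ : Set AE} {φ : AE} {p : ℕ}
    (hΔ : IsStableExpansion S Δ) (hφΔ : φ ∈ Δ)
    (hpS : ∀ ρ ∈ S, var p ∉ subf ρ) (hpφ : var p ∉ subf φ) :
    IsStableExpansion (braveExt S φ p) (substTop p ⁻¹' Δ) := by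
  rw [isStableExpansion_iff] at hΔ ⊢
  have hφ' : φ ∈ substTop p ⁻¹' Δ := by
    rwa [Set.mem_preimage, substTop_of_notMem hpφ]
  have hp' : var p ∈ substTop p ⁻¹' Δ := by
    simp [substTop, hΔ, eval]
  have hM : ∀ v, v ∈ models S (substTop p ⁻¹' Δ) ↔ v ∈ models S Δ := fun v =>
    forall₂_congr fun ρ hρ => by
      rw [← eval_update_of_notMem (hpS ρ hρ) v _ true, ← eval_substTop,
        substTop_of_notMem (hpS ρ hρ)]
  intro ψ
  simp only [mem_models_braveExt, hφ', hp', true_iff, and_true, hM]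
  rw [Set.mem_preimage, hΔ]
  simp only [eval_substTop]
  constructor
  · rintro h v ⟨hv, hvp⟩
    simpa [← hvp] using h v hv
  · intro h v hv
    exact h _ ⟨update_mem_models hpS hv true, by simp⟩

theorem kripkeEval_models_of_isStableExpansion_braveExt {S Δ : Set AE} {φ : AE} {p : ℕ}
    (hΔ : IsStableExpansion (braveExt S φ p) Δ) (hφΔ : φ ∈ Δ) (hpΔ : var p ∈ Δ)
    (hpS : ∀ ρ ∈ S, var p ∉ subf ρ) {ψ : AE} (hψ : var p ∉ subf ψ) (v : ℕ → Bool) :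
    kripkeEval (models S Δ) ψ v = eval v (atomVal Δ) ψ := by
  rw [isStableExpansion_iff] at hΔ
  simp only [mem_models_braveExt, hφΔ, hpΔ, true_iff, and_true] at hΔ
  induction ψ generalizing v with
  | box χ ih =>
    have hχ : var p ∉ subf χ := by simpa [subf] using hψ
    rw [Bool.eq_iff_iff]
    simp only [eval, atomVal_eq_true, kripkeEval, decide_eq_true_eq, ih hχ]
    rw [hΔ χ]
    refine ⟨fun h u hu => h u hu.1, fun h u hu => ?_⟩
    rw [← eval_update_of_notMem hχ u _ true]
    exact h _ ⟨update_mem_models hpS hu true, by simp⟩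
  | _ => simp_all [subf, eval, kripkeEval]

theorem exists_isStableExpansion_of_braveExt {S Δ : Set AE} {φ : AE} {p : ℕ}
    (hΔ : IsStableExpansion (braveExt S φ p) Δ)
    (hpS : ∀ ρ ∈ S, var p ∉ subf ρ) (hpφ : var p ∉ subf φ) :
    ∃ Δ' : Set AE, IsStableExpansion S Δ' ∧ φ ∈ Δ' := by
  have hmem := isStableExpansion_iff.1 hΔ
  have hpΔ : var p ∈ Δ := by
    by_contra h
    exact h ((hmem _).2 fun v hv => absurd (mem_models_braveExt.1 hv).2.2 h)
  have hφΔ : φ ∈ Δ := by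
    by_contra h
    exact h ((hmem _).2 fun v hv => absurd
      ((mem_models_braveExt.1 hv).2.1.2 ((hmem _).1 hpΔ v hv)) h)
  have hagree := fun {ψ : AE} (hψ : var p ∉ subf ψ) =>
    kripkeEval_models_of_isStableExpansion_braveExt hΔ hφΔ hpΔ hpS hψ
  refine ⟨kripkeTheory (models S Δ), isStableExpansion_kripkeTheory ?_, ?_⟩
  · ext v
    refine forall₂_congr fun ρ hρ => ?_
    rw [eval_kripkeTheory, hagree (hpS ρ hρ)]
  · have hbox : var p ∉ subf (box φ) := by simpa [subf] using hpφ
    have h : atomVal (kripkeTheory (models S Δ)) φ = atomVal Δ φ :=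
      (eval_kripkeTheory _ (fun _ => true) (box φ)).trans (hagree hbox _)
    rw [← atomVal_eq_true, h, atomVal_eq_true]
    exact hφΔ

/-- Brave reasoning reduces to expansion existence for `⊕,⊤`-formulas:
`φ` is in some stable expansion of `Σ` iff
`Σ' = Σ ∪ {Lφ ⊕ p ⊕ ⊤, Lp}` has a stable expansion (`p` fresh). -/
theorem brave_reduces_to_exp (S : Set AE) (φ : AE) (p : ℕ)
    (hS : ∀ ρ ∈ S, IsXorTop ρ) (hφ : IsXorTop φ)
    (hpS : ∀ ρ ∈ S, var p ∉ subf ρ) (hpφ : var p ∉ subf φ) :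
    (∃ Δ : Set AE, IsStableExpansion S Δ ∧ φ ∈ Δ) ↔
    ∃ Δ : Set AE,
      IsStableExpansion (S ∪ {xor (box φ) (xor (var p) top), box (var p)}) Δ :=
  ⟨fun ⟨_, hΔ, hφΔ⟩ => ⟨_, hΔ.braveExt hφΔ hpS hpφ⟩,
    fun ⟨_, hΔ⟩ => exists_isStableExpansion_of_braveExt hΔ hpS hpφ⟩

end AE
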